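/- arXiv:2408.13548 — 3 statements merged into one kernel-verified Lean document; each statement's English description precedes it below -/
import Mathlib

section
/- Let A be an abelian category and let (U, V) be a complete cotorsion pair in A. Then the pair (Mon(U), Epi(V)) is a weak factorization system on A. -/
open CategoryTheory CategoryTheory.Limits

universe v u

section GeneralDefs

variable {C : Type u} [Category.{v} C]

/-- `HasLift l r` means `l` has the left lifting property with respect to `r`
(equivalently `r` has the right lifting property with respect to `l`): written `l □ r`. -/
def HasLift {X Y Z W : C} (l : X ⟶ Y) (r : Z ⟶ W) : Prop :=
  ∀ (f : X ⟶ Z) (g : Y ⟶ W), l ≫ g = f ≫ r →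
    ∃ t : Y ⟶ Z, l ≫ t = f ∧ t ≫ r = g

/-- `(L, R)` is a weak factorization system: `L = ^□R`, `R = L^□`, and every morphism
factors as a morphism in `L` followed by a morphism in `R`. -/
def IsWFS (L R : MorphismProperty C) : Prop :=
  (∀ {X Y : C} (f : X ⟶ Y), L f ↔ ∀ {Z W : C} (r : Z ⟶ W), R r → HasLift f r) ∧
  (∀ {X Y : C} (g : X ⟶ Y), R g ↔ ∀ {Z W : C} (l : Z ⟶ W), L l → HasLift l g) ∧
  (∀ {X Y : C} (h : X ⟶ Y), ∃ (Z : C) (f : X ⟶ Z) (g : Z ⟶ Y), L f ∧ R g ∧ f ≫ g = h)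

/-- `L` satisfies the left cancellation property: `β ∘ α ∈ L` and `β ∈ L` imply `α ∈ L`. -/
def LeftCancel (L : MorphismProperty C) : Prop :=
  ∀ {X Y Z : C} (α : X ⟶ Y) (β : Y ⟶ Z), L (α ≫ β) → L β → L α

/-- `R` satisfies the right cancellation property: `β ∘ α ∈ R` and `α ∈ R` imply `β ∈ R`. -/
def RightCancel (R : MorphismProperty C) : Prop :=
  ∀ {X Y Z : C} (α : X ⟶ Y) (β : Y ⟶ Z), R (α ≫ β) → R α → R β

/-- The weak factorization systems `(L, Rt)` and `(Lt, R)` are compatible: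
(CP1) `Lt ⊆ L`; (CP2) two-out-of-three for `Rt` among composable morphisms of `R`;
(CP3) if `l ∈ Lt`, `r ∈ R` and `r ∘ l ∈ Lt` then `r ∈ Rt`. -/
def CompatWFS (L Rt Lt R : MorphismProperty C) : Prop :=
  (∀ {X Y : C} (f : X ⟶ Y), Lt f → L f) ∧
  (∀ {X Y Z : C} (α : X ⟶ Y) (β : Y ⟶ Z), R α → R β →
    (Rt α → Rt β → Rt (α ≫ β)) ∧ (Rt α → Rt (α ≫ β) → Rt β) ∧
    (Rt β → Rt (α ≫ β) → Rt α)) ∧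
  (∀ {X Y Z : C} (l : X ⟶ Y) (r : Y ⟶ Z), Lt l → R r → Lt (l ≫ r) → Rt r)

end GeneralDefs

section AbelianDefs

variable {A : Type u} [Category.{v} A] [Abelian A]

/-- `0 → X → Y → Z → 0` is a short exact sequence. -/
def IsSES {X Y Z : A} (i : X ⟶ Y) (p : Y ⟶ Z) : Prop :=
  ∃ w : i ≫ p = 0, (ShortComplex.mk i p w).ShortExact

/-- `Mon(U)`: monomorphisms with cokernel in `U`. -/
def MonCl (U : A → Prop) : MorphismProperty A :=
  fun _ _ f => Mono f ∧ U (cokernel f)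

/-- `Epi(V)`: epimorphisms with kernel in `V`. -/
def EpiCl (V : A → Prop) : MorphismProperty A :=
  fun _ _ g => Epi g ∧ V (kernel g)

/-- `(U, V)` is a complete cotorsion pair: both classes are closed under isomorphisms and
direct summands, every short exact sequence `0 → V' → E → U' → 0` with `U' ∈ U`, `V' ∈ V`
splits (i.e. `Ext^1(U, V) = 0`), and every object admits the two approximation sequences. -/
structure IsCompleteCotorsionPair (U V : A → Prop) : Prop where
  isoU : ∀ {X Y : A}, (X ≅ Y) → U X → U Y
  isoV : ∀ {X Y : A}, (X ≅ Y) → V X → V Y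
  summandU : ∀ {X Z : A} (i : X ⟶ Z) (r : Z ⟶ X), i ≫ r = 𝟙 X → U Z → U X
  summandV : ∀ {X Z : A} (i : X ⟶ Z) (r : Z ⟶ X), i ≫ r = 𝟙 X → V Z → V X
  ext_zero : ∀ {V' E U' : A} (i : V' ⟶ E) (p : E ⟶ U'),
    V V' → U U' → IsSES i p → ∃ s : E ⟶ V', i ≫ s = 𝟙 V'
  complete_left : ∀ C : A, ∃ (V' U' : A) (i : V' ⟶ U') (p : U' ⟶ C),
    U U' ∧ V V' ∧ IsSES i p
  complete_right : ∀ C : A, ∃ (V' U' : A) (i : C ⟶ V') (p : V' ⟶ U'),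
    U U' ∧ V V' ∧ IsSES i p

end AbelianDefs

section CotorsionPairs

variable {A : Type u} [Category.{v} A] [Abelian A] {U V : A → Prop}

open scoped ZeroObject

namespace IsSES

variable {X Y Z : A} {i : X ⟶ Y} {p : Y ⟶ Z}

lemma monCl (hUV : IsCompleteCotorsionPair U V) (h : IsSES i p) (hZ : U Z) :
    MonCl U i := by
  obtain ⟨w, h⟩ := h
  exact ⟨h.mono_f, hUV.isoU
    (h.gIsCokernel.coconePointUniqueUpToIso (colimit.isColimit _)) hZ⟩

lemma epiCl (hUV : IsCompleteCotorsionPair U V) (h : IsSES i p) (hX : V X) :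
    EpiCl V p := by
  obtain ⟨w, h⟩ := h
  exact ⟨h.epi_g, hUV.isoV
    (h.fIsKernel.conePointUniqueUpToIso (limit.isLimit _)) hX⟩

end IsSES

lemma isSES_zero_id (X : A) : IsSES (0 : (0 : A) ⟶ X) (𝟙 X) :=
  ⟨by simp, ⟨(ShortComplex.exact_iff_mono _ rfl).2 (by dsimp; infer_instance)⟩⟩

lemma isSES_id_zero (X : A) : IsSES (𝟙 X) (0 : X ⟶ (0 : A)) :=
  ⟨by simp, ⟨(ShortComplex.exact_iff_epi _ rfl).2 (by dsimp; infer_instance)⟩⟩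

lemma isSES_biprod (X Y : A) :
    IsSES (biprod.inl : X ⟶ X ⊞ Y) (biprod.snd : X ⊞ Y ⟶ Y) :=
  ⟨by simp, (ShortComplex.Splitting.ofHasBinaryBiproduct X Y).shortExact⟩

/-- If a section over the subobject `l : X ⟶ Y` of an extension `i, p` of `Y` is given, then
dividing it out yields an extension of the cokernel of `l`. -/
lemma isSES_cokernel_of_section {K P Y X : A} {i : K ⟶ P} {p : P ⟶ Y} (h : IsSES i p)
    (l : X ⟶ Y) [Mono l] (e : X ⟶ P) (he : e ≫ p = l) :
    IsSES (i ≫ cokernel.π e) (cokernel.desc e (p ≫ cokernel.π l)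
      (by rw [reassoc_of% he, cokernel.condition])) := by
  obtain ⟨w, h⟩ := h
  have := h.mono_f
  have := h.epi_g
  dsimp at *
  have : Mono e := by
    have : Mono (e ≫ p) := by rw [he]; infer_instance
    exact mono_of_mono e p
  refine ⟨by simp [reassoc_of% w], ?_⟩
  have hm : Mono (i ≫ cokernel.π e) := by
    refine Preadditive.mono_of_cancel_zero _ fun {T} k hk => ?_
    have hk' : (k ≫ i) ≫ cokernel.π e = 0 := by simpa using hk
    have hx : Abelian.monoLift e (k ≫ i) hk' ≫ e = k ≫ i := Abelian.monoLift_comp _ _ _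
    have hx0 : Abelian.monoLift e (k ≫ i) hk' = 0 := by
      rw [← cancel_mono l, ← he, reassoc_of% hx, w]
      simp
    rw [← cancel_mono i, ← hx, hx0]
    simp
  refine ShortComplex.ShortExact.mk' ?_ hm ?_
  · rw [ShortComplex.exact_iff_exact_up_to_refinements]
    intro T a ha
    dsimp at a ha
    obtain ⟨T', q, hq, b, hb⟩ := surjective_up_to_refinements_of_epi (cokernel.π e) a
    have hbp : (b ≫ p) ≫ cokernel.π l = 0 := by
      have := q ≫= ha
      rw [reassoc_of% hb] at this
      simpa using this
    have hx : Abelian.monoLift l (b ≫ p) hbp ≫ l = b ≫ p := Abelian.monoLift_comp _ _ _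
    have hk : (b - Abelian.monoLift l (b ≫ p) hbp ≫ e) ≫ p = 0 := by
      simp [Preadditive.sub_comp, he, hx]
    obtain ⟨k, hk⟩ : ∃ k : T' ⟶ K, k ≫ i = b - Abelian.monoLift l (b ≫ p) hbp ≫ e :=
      ⟨h.exact.lift _ hk, h.exact.lift_f _ hk⟩
    refine ⟨T', q, hq, k, ?_⟩
    dsimp
    rw [reassoc_of% hk, hb]
    simp [Preadditive.sub_comp]
  · dsimp
    have : Epi (cokernel.π e ≫ cokernel.desc e (p ≫ cokernel.π l)
      (by rw [reassoc_of% he, cokernel.condition])) := by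
      rw [cokernel.π_desc]
      infer_instance
    exact epi_of_epi (cokernel.π e) _

/-- A partial section of an extension by `V`, defined on a subobject with cokernel in `U`,
extends to a section. -/
lemma IsCompleteCotorsionPair.exists_section_extension (hUV : IsCompleteCotorsionPair U V)
    {K P Y X : A} {i : K ⟶ P} {p : P ⟶ Y} (h : IsSES i p) (hK : V K)
    {l : X ⟶ Y} (hl : MonCl U l) (e : X ⟶ P) (he : e ≫ p = l) :
    ∃ s : Y ⟶ P, l ≫ s = e ∧ s ≫ p = 𝟙 Y := by
  have := hl.1
  obtain ⟨r, hr⟩ := hUV.ext_zero _ _ hK hl.2 (isSES_cokernel_of_section h l e he)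
  obtain ⟨w, h⟩ := h
  have := h.epi_g
  dsimp at *
  have h₀ : i ≫ (𝟙 P - cokernel.π e ≫ r ≫ i) = 0 := by
    simp only [Category.assoc] at hr
    simp [Preadditive.comp_sub, reassoc_of% hr]
  obtain ⟨s, hs⟩ : ∃ s : Y ⟶ P, p ≫ s = 𝟙 P - cokernel.π e ≫ r ≫ i :=
    ⟨h.exact.desc _ h₀, h.exact.g_desc _ h₀⟩
  refine ⟨s, ?_, ?_⟩
  · rw [← he, Category.assoc, hs]
    simp [Preadditive.comp_sub]
  · rw [← cancel_epi p, reassoc_of% hs]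
    simp [Preadditive.sub_comp, w]

lemma isSES_pullback_fst {Z W Y : A} (g : Y ⟶ W) (r : Z ⟶ W) [Epi r] :
    IsSES (pullback.lift 0 (kernel.ι r) (by simp) : kernel r ⟶ pullback g r)
      (pullback.fst g r) := by
  have hm : Mono (pullback.lift 0 (kernel.ι r) (by simp) : kernel r ⟶ pullback g r) :=
    mono_of_mono_fac (pullback.lift_snd _ _ _)
  refine ⟨pullback.lift_fst _ _ _, ShortComplex.ShortExact.mk' ?_ hm (by dsimp; infer_instance)⟩
  refine ShortComplex.exact_of_f_is_kernel _ (KernelFork.IsLimit.ofι' _ _ fun {T} k hk => ?_)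
  dsimp at k hk
  refine ⟨kernel.lift r (k ≫ pullback.snd g r) ?_, ?_⟩
  · rw [Category.assoc, ← pullback.condition, reassoc_of% hk, zero_comp]
  · apply pullback.hom_ext
    · rw [Category.assoc, pullback.lift_fst, comp_zero, hk]
    · rw [Category.assoc, pullback.lift_snd, kernel.lift_ι]

lemma isSES_pushout_desc {K X Y W : A} {i : K ⟶ X} {p : X ⟶ Y} (h : IsSES i p)
    (j : K ⟶ W) :
    IsSES (pushout.inr i j)
      (pushout.desc p 0 (by simpa using h.1) : pushout i j ⟶ Y) := by
  obtain ⟨w, h⟩ := h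
  have := h.mono_f
  have := h.epi_g
  dsimp at *
  have hp : Epi (pushout.desc p 0 (by simpa using w) : pushout i j ⟶ Y) :=
    epi_of_epi_fac (pushout.inl_desc _ _ _)
  refine ⟨pushout.inr_desc _ _ _, ShortComplex.ShortExact.mk' ?_ (by dsimp; infer_instance) hp⟩
  refine ShortComplex.exact_of_g_is_cokernel _
    (CokernelCofork.IsColimit.ofπ' _ _ fun {T} k hk => ?_)
  dsimp at k hk
  have h₀ : i ≫ pushout.inl i j ≫ k = 0 := by
    rw [pushout.condition_assoc, hk, comp_zero]
  refine ⟨h.exact.desc _ h₀, ?_⟩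
  apply pushout.hom_ext
  · rw [pushout.inl_desc_assoc]
    exact h.exact.g_desc _ h₀
  · rw [pushout.inr_desc_assoc, zero_comp, hk]

namespace IsCompleteCotorsionPair

lemma hasLift (hUV : IsCompleteCotorsionPair U V)
    {X Y Z W : A} {l : X ⟶ Y} {r : Z ⟶ W} (hl : MonCl U l) (hr : EpiCl V r) :
    HasLift l r := by
  intro f g w
  have := hr.1
  obtain ⟨s, hs, hs'⟩ := hUV.exists_section_extension (isSES_pullback_fst g r) hr.2 hl
    (pullback.lift l f w) (pullback.lift_fst _ _ _)
  refine ⟨s ≫ pullback.snd g r, by rw [reassoc_of% hs, pullback.lift_snd], ?_⟩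
  rw [Category.assoc, ← pullback.condition, reassoc_of% hs']

lemma monCl_iff (hUV : IsCompleteCotorsionPair U V) {X Y : A} (f : X ⟶ Y) :
    MonCl U f ↔ ∀ {Z W : A} (r : Z ⟶ W), EpiCl V r → HasLift f r := by
  refine ⟨fun hf _ _ r hr => hUV.hasLift hf hr, fun hf => ⟨?_, ?_⟩⟩
  · obtain ⟨V', U', i, p, -, hV, w, h⟩ := hUV.complete_right X
    have := h.mono_f
    obtain ⟨t, ht, -⟩ := hf (0 : V' ⟶ (0 : A)) ((isSES_id_zero V').epiCl hUV hV) i 0 (by simp)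
    exact mono_of_mono_fac ht
  · obtain ⟨V', U', i, p, hU, hV, h⟩ := hUV.complete_left (cokernel f)
    obtain ⟨t, ht, ht'⟩ := hf p (h.epiCl hUV hV) 0 (cokernel.π f) (by simp)
    refine hUV.summandU (cokernel.desc f t ht) p ?_ hU
    rw [← cancel_epi (cokernel.π f)]
    simp [ht']

lemma epiCl_iff (hUV : IsCompleteCotorsionPair U V) {X Y : A} (g : X ⟶ Y) :
    EpiCl V g ↔ ∀ {Z W : A} (l : Z ⟶ W), MonCl U l → HasLift l g := by
  refine ⟨fun hg _ _ l hl => hUV.hasLift hl hg, fun hg => ⟨?_, ?_⟩⟩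
  · obtain ⟨V', U', i, p, hU, -, w, h⟩ := hUV.complete_left Y
    have := h.epi_g
    obtain ⟨t, -, ht⟩ := hg (0 : (0 : A) ⟶ U') ((isSES_zero_id U').monCl hUV hU) 0 p (by simp)
    exact epi_of_epi_fac ht
  · obtain ⟨V', U', i, p, hU, hV, h⟩ := hUV.complete_right (kernel g)
    obtain ⟨t, ht, ht'⟩ := hg i (h.monCl hUV hU) (kernel.ι g) 0 (by simp)
    refine hUV.summandV i (kernel.lift g t ht') ?_ hV
    rw [← cancel_mono (kernel.ι g)]
    simp [ht]

lemma monCl_comp (hUV : IsCompleteCotorsionPair U V)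
    {X Y Z : A} {f : X ⟶ Y} {g : Y ⟶ Z} (hf : MonCl U f) (hg : MonCl U g) :
    MonCl U (f ≫ g) := by
  refine (hUV.monCl_iff _).2 fun r hr a b w => ?_
  obtain ⟨s, hs, hs'⟩ := hUV.hasLift hf hr a (g ≫ b) (by simpa using w)
  obtain ⟨t, ht, ht'⟩ := hUV.hasLift hg hr s b hs'.symm
  exact ⟨t, by rw [Category.assoc, ht, hs], ht'⟩

lemma monCl_pushout_inl (hUV : IsCompleteCotorsionPair U V)
    {K X W : A} (i : K ⟶ X) {j : K ⟶ W} (hj : MonCl U j) :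
    MonCl U (pushout.inl i j) := by
  refine (hUV.monCl_iff _).2 fun r hr a b w => ?_
  obtain ⟨t, ht, ht'⟩ := hUV.hasLift hj hr (i ≫ a) (pushout.inr i j ≫ b) (by
    rw [← pushout.condition_assoc, w, Category.assoc])
  refine ⟨pushout.desc a t ht.symm, pushout.inl_desc _ _ _, ?_⟩
  apply pushout.hom_ext
  · rw [pushout.inl_desc_assoc, w]
  · rw [pushout.inr_desc_assoc, ht']

lemma exists_factorization_of_epi (hUV : IsCompleteCotorsionPair U V) {X Y : A} (h : X ⟶ Y) [Epi h] :
    ∃ (Z : A) (f : X ⟶ Z) (g : Z ⟶ Y), MonCl U f ∧ EpiCl V g ∧ f ≫ g = h := by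
  obtain ⟨V', U', j, p, hU, hV, hj⟩ := hUV.complete_right (kernel h)
  have hh : IsSES (kernel.ι h) h := ⟨by simp, ShortComplex.ShortExact.mk'
    (ShortComplex.exact_of_f_is_kernel _ (kernelIsKernel h)) (by dsimp; infer_instance)
    inferInstance⟩
  exact ⟨_, _, _, hUV.monCl_pushout_inl (kernel.ι h) (hj.monCl hUV hU),
    (isSES_pushout_desc hh j).epiCl hUV hV, pushout.inl_desc _ _ _⟩

lemma exists_factorization (hUV : IsCompleteCotorsionPair U V) {X Y : A} (h : X ⟶ Y) :
    ∃ (Z : A) (f : X ⟶ Z) (g : Z ⟶ Y), MonCl U f ∧ EpiCl V g ∧ f ≫ g = h := by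
  obtain ⟨V', U', i, p, hU, -, w, hp⟩ := hUV.complete_left Y
  have := hp.epi_g
  have : Epi (biprod.desc h p) := epi_of_epi_fac (biprod.inr_desc h p)
  obtain ⟨Z, f, g, hf, hg, hfg⟩ := hUV.exists_factorization_of_epi (biprod.desc h p)
  exact ⟨Z, biprod.inl ≫ f, g, hUV.monCl_comp ((isSES_biprod X U').monCl hUV hU) hf, hg,
    by rw [Category.assoc, hfg, biprod.inl_desc]⟩

end IsCompleteCotorsionPair

end CotorsionPairs

variable {A : Type u} [Category.{v} A] [Abelian A]

/-- For a complete cotorsion pair `(U, V)` in an abelian category, the pair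
`(Mon(U), Epi(V))` is a weak factorization system. -/
theorem stmt5 (U V : A → Prop) (hUV : IsCompleteCotorsionPair U V) :
    IsWFS (MonCl U) (EpiCl V) := by
  exact ⟨hUV.monCl_iff, hUV.epiCl_iff, hUV.exists_factorization⟩
end

section
/- Let A be an abelian category and let U and V be classes of objects of A, each closed under isomorphisms. If the pair (Mon(U), Epi(V)) is a weak factorization system on A, then (U, V) is a complete cotorsion pair in A; in particular U and V are closed under direct summands, Ext^1(U, V) = 0 for all U ∈ U and V ∈ V, and every object C admits short exact sequences 0 → V^C → U^C → C → 0 and 0 → C → V_C → U_C → 0 with U^C, U_C ∈ U and V^C, V_C ∈ V. -/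
open CategoryTheory CategoryTheory.Limits

universe v u

variable {A : Type u} [Category.{v} A] [Abelian A]

lemma MonCl.zero_iff {U : A → Prop} (hU : ∀ {X Y : A}, (X ≅ Y) → U X → U Y) {Z X : A}
    (hZ : IsZero Z) (f : Z ⟶ X) : MonCl U f ↔ U X := by
  obtain rfl : f = 0 := hZ.eq_of_src _ _
  have e : cokernel (0 : Z ⟶ X) ≅ X := cokernelZeroIsoTarget
  exact ⟨fun h => hU e h.2, fun h => ⟨⟨fun _ _ _ => hZ.eq_of_tgt _ _⟩, hU e.symm h⟩⟩

lemma EpiCl.zero_iff {V : A → Prop} (hV : ∀ {X Y : A}, (X ≅ Y) → V X → V Y) {X Z : A}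
    (hZ : IsZero Z) (f : X ⟶ Z) : EpiCl V f ↔ V X := by
  obtain rfl : f = 0 := hZ.eq_of_tgt _ _
  have e : kernel (0 : X ⟶ Z) ≅ X := kernelZeroIsoSource
  exact ⟨fun h => hV e h.2, fun h => ⟨⟨fun _ _ _ => hZ.eq_of_src _ _⟩, hV e.symm h⟩⟩

lemma IsSES.of_mono {X Y : A} (i : X ⟶ Y) [Mono i] : IsSES i (cokernel.π i) :=
  ⟨cokernel.condition i,
    { exact := ShortComplex.exact_cokernel i
      mono_f := inferInstanceAs (Mono i)
      epi_g := inferInstanceAs (Epi (cokernel.π i)) }⟩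

lemma IsSES.of_epi {X Y : A} (p : X ⟶ Y) [Epi p] : IsSES (kernel.ι p) p :=
  ⟨kernel.condition p,
    { exact := ShortComplex.exact_kernel p
      mono_f := inferInstanceAs (Mono (kernel.ι p))
      epi_g := inferInstanceAs (Epi p) }⟩

lemma IsSES.monCl_s6 {U : A → Prop} (hU : ∀ {X Y : A}, (X ≅ Y) → U X → U Y) {X Y Z : A}
    {i : X ⟶ Y} {p : Y ⟶ Z} (h : IsSES i p) (hZ : U Z) : MonCl U i := by
  obtain ⟨w, h⟩ := h
  exact ⟨h.mono_f, hU (h.gIsCokernel.coconePointUniqueUpToIso (colimit.isColimit _)) hZ⟩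

/-- If `U` and `V` are iso-closed classes of objects of an abelian category such that
`(Mon(U), Epi(V))` is a weak factorization system, then `(U, V)` is a complete
cotorsion pair. -/
theorem stmt6 (U V : A → Prop)
    (hU : ∀ {X Y : A}, (X ≅ Y) → U X → U Y)
    (hV : ∀ {X Y : A}, (X ≅ Y) → V X → V Y)
    (hwfs : IsWFS (MonCl U) (EpiCl V)) :
    IsCompleteCotorsionPair U V := by
  obtain ⟨hL, hR, hfac⟩ := hwfs
  obtain ⟨O, h0⟩ := HasZeroObject.zero (C := A)
  refine ⟨hU, hV, ?_, ?_, ?_, ?_, ?_⟩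
  · intro X Z i r hir hZ
    rw [← MonCl.zero_iff hU h0 (0 : O ⟶ X), hL]
    intro P Q q hq f g _
    obtain ⟨t, -, ht⟩ := (hL _).1 ((MonCl.zero_iff hU h0 (0 : O ⟶ Z)).2 hZ) q hq f (r ≫ g)
      (h0.eq_of_src _ _)
    exact ⟨i ≫ t, h0.eq_of_src _ _, by rw [Category.assoc, ht, reassoc_of% hir]⟩
  · intro X Z i r hir hZ
    rw [← EpiCl.zero_iff hV h0 (0 : X ⟶ O), hR]
    intro P Q l hl f g _
    obtain ⟨t, ht, -⟩ := (hR _).1 ((EpiCl.zero_iff hV h0 (0 : Z ⟶ O)).2 hZ) l hl (f ≫ i) g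
      (h0.eq_of_tgt _ _)
    exact ⟨t ≫ r, by rw [reassoc_of% ht, hir, Category.comp_id], h0.eq_of_tgt _ _⟩
  · intro V' E U' i p hV' hU' h
    obtain ⟨s, hs, -⟩ := (hL i).1 (h.monCl_s6 hU hU') (0 : V' ⟶ O)
      ((EpiCl.zero_iff hV h0 _).2 hV') (𝟙 V') 0 (h0.eq_of_tgt _ _)
    exact ⟨s, hs⟩
  · intro C
    obtain ⟨Z, f, g, hf, ⟨_, hg⟩, -⟩ := hfac (0 : O ⟶ C)
    exact ⟨_, Z, kernel.ι g, g, (MonCl.zero_iff hU h0 f).1 hf, hg, .of_epi g⟩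
  · intro C
    obtain ⟨Z, f, g, ⟨_, hf⟩, hg, -⟩ := hfac (0 : C ⟶ O)
    exact ⟨Z, _, f, cokernel.π f, hf, (EpiCl.zero_iff hV h0 g).1 hg, .of_mono f⟩
end

section
/- Let T be a triangulated category and let (U, V) be a pair of classes of objects of T, each closed under isomorphisms and direct summands. Then the following are equivalent: (1) (U, V) is a co-t-structure on T; (2) (Infl(U), Defl(V)) is a weak factorization system on T such that Infl(U) satisfies the left cancellation property; (3) (Infl(U), Defl(V)) is a weak factorization system on T such that Defl(V) satisfies the right cancellation property. -/
open CategoryTheory CategoryTheory.Limits CategoryTheory.Pretriangulated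

universe v u

section TriangulatedDefs

variable {T : Type u} [Category.{v} T] [HasZeroObject T] [HasShift T ℤ]
  [Preadditive T] [∀ n : ℤ, (shiftFunctor T n).Additive] [Pretriangulated T]

/-- `Infl(U)`: morphisms `f : X ⟶ Y` fitting into a distinguished triangle
`X → Y → Z → X[1]` with cone `Z ∈ U`. -/
def InflCl (U : T → Prop) : MorphismProperty T :=
  fun X Y f => ∃ (Z : T) (g : Y ⟶ Z) (h : Z ⟶ X⟦(1:ℤ)⟧),
    Triangle.mk f g h ∈ (distTriang T) ∧ U Z

/-- `Defl(V)`: morphisms `g : X ⟶ Y` fitting into a distinguished triangle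
`W → X → Y → W[1]` with cocone `W ∈ V`. -/
def DeflCl (V : T → Prop) : MorphismProperty T :=
  fun X Y g => ∃ (W : T) (w : W ⟶ X) (h : Y ⟶ W⟦(1:ℤ)⟧),
    Triangle.mk w g h ∈ (distTriang T) ∧ V W

/-- `(U, V)` is a cotorsion pair on the triangulated category `T`: both classes closed
under isomorphisms and direct summands, `Hom(U, V[1]) = 0`, and every object admits the
two approximation triangles. -/
structure IsTriCotorsionPair (U V : T → Prop) : Prop where
  isoU : ∀ {X Y : T}, (X ≅ Y) → U X → U Y
  isoV : ∀ {X Y : T}, (X ≅ Y) → V X → V Y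
  summandU : ∀ {X Z : T} (i : X ⟶ Z) (r : Z ⟶ X), i ≫ r = 𝟙 X → U Z → U X
  summandV : ∀ {X Z : T} (i : X ⟶ Z) (r : Z ⟶ X), i ≫ r = 𝟙 X → V Z → V X
  hom_zero : ∀ {X Y : T}, U X → V Y → ∀ f : X ⟶ Y⟦(1:ℤ)⟧, f = 0
  tri_left : ∀ C : T, ∃ (V' U' : T) (i : V' ⟶ U') (p : U' ⟶ C) (h : C ⟶ V'⟦(1:ℤ)⟧),
    Triangle.mk i p h ∈ (distTriang T) ∧ U U' ∧ V V'
  tri_right : ∀ C : T, ∃ (V' U' : T) (i : C ⟶ V') (p : V' ⟶ U') (h : U' ⟶ C⟦(1:ℤ)⟧),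
    Triangle.mk i p h ∈ (distTriang T) ∧ U U' ∧ V V'

/-- `(U, V)` is a co-t-structure on `T`: `U[-1] ⊆ U`, `V[1] ⊆ V`,
`Hom(U[-1], V) = 0`, and every object `C` fits in a distinguished triangle
`X → C → Y → X[1]` with `X ∈ U[-1]` and `Y ∈ V`. -/
structure IsCoTStructure (U V : T → Prop) : Prop where
  shiftU : ∀ X : T, U X → U (X⟦(-1:ℤ)⟧)
  shiftV : ∀ X : T, V X → V (X⟦(1:ℤ)⟧)
  hom_zero : ∀ {X Y : T}, U X → V Y → ∀ f : X⟦(-1:ℤ)⟧ ⟶ Y, f = 0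
  exists_tri : ∀ C : T, ∃ (X Y : T) (i : X ⟶ C) (p : C ⟶ Y) (h : Y ⟶ X⟦(1:ℤ)⟧),
    Triangle.mk i p h ∈ (distTriang T) ∧ U (X⟦(1:ℤ)⟧) ∧ V Y

end TriangulatedDefs

section Cotorsion

variable {T : Type u} [Category.{v} T] [HasShift T ℤ]
  [Preadditive T] [∀ n : ℤ, (shiftFunctor T n).Additive]

lemma hom_shift_eq_zero {X W : T} (h : ∀ g : X⟦(-1 : ℤ)⟧ ⟶ W, g = 0)
    (f : X ⟶ W⟦(1 : ℤ)⟧) : f = 0 := by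
  apply (shiftFunctor T (-1 : ℤ)).map_injective
  rw [Functor.map_zero,
    ← cancel_mono ((shiftFunctorCompIsoId T (1 : ℤ) (-1) (by simp)).hom.app W), zero_comp]
  exact h _

lemma hom_shift_neg_eq_zero {X W : T} (h : ∀ f : X ⟶ W⟦(1 : ℤ)⟧, f = 0)
    (g : X⟦(-1 : ℤ)⟧ ⟶ W) : g = 0 := by
  apply (shiftFunctor T (1 : ℤ)).map_injective
  rw [Functor.map_zero,
    ← cancel_epi ((shiftFunctorCompIsoId T (-1 : ℤ) 1 (by simp)).inv.app X), comp_zero]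
  exact h _

variable [HasZeroObject T] [Pretriangulated T]

open ZeroObject

lemma distTriang_of_iso₃ {X Y Z Z' : T} {f : X ⟶ Y} {g : Y ⟶ Z} {h : Z ⟶ X⟦(1 : ℤ)⟧}
    (H : Triangle.mk f g h ∈ distTriang T) (e : Z ≅ Z') :
    Triangle.mk f (g ≫ e.hom) (e.inv ≫ h) ∈ distTriang T :=
  isomorphic_distinguished _ H _
    (Triangle.isoMk _ _ (Iso.refl X) (Iso.refl Y) e.symm
      ((Category.comp_id f).trans (Category.id_comp f).symm)
      (by change (g ≫ e.hom) ≫ e.inv = 𝟙 Y ≫ g; simp)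
      (by change (e.inv ≫ h) ≫ (𝟙 X)⟦(1 : ℤ)⟧' = e.inv ≫ h; simp))

lemma exists_hom_shift_neg_exact {X Y Z : T} {f : X ⟶ Y} {g : Y ⟶ Z} {h : Z ⟶ X⟦(1 : ℤ)⟧}
    (H : Triangle.mk f g h ∈ distTriang T) :
    ∃ δ : Z⟦(-1 : ℤ)⟧ ⟶ X, δ ≫ f = 0 ∧
      ∀ {A : T} (k : X ⟶ A), δ ≫ k = 0 → ∃ k' : Y ⟶ A, k = f ≫ k' :=
  ⟨(Triangle.mk f g h).invRotate.mor₁,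
    comp_distTriang_mor_zero₁₂ _ (inv_rot_of_distTriang _ H),
    fun k hk => Triangle.yoneda_exact₂ _ (inv_rot_of_distTriang _ H) k hk⟩

lemma distTriang_to_zero (X : T) :
    Triangle.mk (0 : X⟦(-1 : ℤ)⟧ ⟶ 0) 0 ((shiftFunctorCompIsoId T (-1 : ℤ) 1 (by simp)).inv.app X)
      ∈ distTriang T := by
  simpa using distTriang_of_iso₃ (contractible_distinguished₂ (X⟦(-1 : ℤ)⟧))
    ((shiftFunctorCompIsoId T (-1 : ℤ) 1 (by simp)).app X)

variable {U V : T → Prop}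

namespace IsCoTStructure

lemma isTriCotorsionPair (H : IsCoTStructure U V)
    (hU : ∀ {X Y : T}, (X ≅ Y) → U X → U Y)
    (hV : ∀ {X Y : T}, (X ≅ Y) → V X → V Y)
    (hUs : ∀ {X Z : T} (i : X ⟶ Z) (r : Z ⟶ X), i ≫ r = 𝟙 X → U Z → U X)
    (hVs : ∀ {X Z : T} (i : X ⟶ Z) (r : Z ⟶ X), i ≫ r = 𝟙 X → V Z → V X) :
    IsTriCotorsionPair U V where
  isoU := hU
  isoV := hV
  summandU := hUs
  summandV := hVs
  hom_zero hX hY f := hom_shift_eq_zero (H.hom_zero hX hY) f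
  tri_left C := by
    obtain ⟨X, Y, i, p, h, mem, hX, hY⟩ := H.exists_tri (C⟦(-1 : ℤ)⟧)
    exact ⟨Y, X⟦(1 : ℤ)⟧, _, _, _,
      distTriang_of_iso₃ (rot_of_distTriang _ (rot_of_distTriang _ mem))
        ((shiftFunctorCompIsoId T (-1 : ℤ) 1 (by simp)).app C), hX, hY⟩
  tri_right C := by
    obtain ⟨X, Y, i, p, h, mem, hX, hY⟩ := H.exists_tri C
    exact ⟨Y, X⟦(1 : ℤ)⟧, _, _, _, rot_of_distTriang _ mem, hX, hY⟩

end IsCoTStructure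

namespace IsTriCotorsionPair

lemma mem_left_of_hom_zero (H : IsTriCotorsionPair U V) {X : T}
    (hX : ∀ W, V W → ∀ f : X ⟶ W⟦(1 : ℤ)⟧, f = 0) : U X := by
  obtain ⟨W, Z, i, p, h, mem, hZ, hW⟩ := H.tri_left X
  obtain ⟨s, hs⟩ := Triangle.coyoneda_exact₃ _ mem (𝟙 X) 
    ((congrArg (𝟙 X ≫ ·) (hX W hW h)).trans comp_zero)
  exact H.summandU s p hs.symm hZ

lemma mem_right_of_hom_zero (H : IsTriCotorsionPair U V) {X : T}
    (hX : ∀ Z, U Z → ∀ f : Z ⟶ X⟦(1 : ℤ)⟧, f = 0) : V X := by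
  obtain ⟨W, Z, i, p, h, mem, hZ, hW⟩ := H.tri_right X
  obtain ⟨δ, -, hδ⟩ := exists_hom_shift_neg_exact mem
  obtain ⟨r, hr⟩ := hδ (𝟙 X) (by rw [hom_shift_neg_eq_zero (hX Z hZ) δ, zero_comp])
  exact H.summandV i r hr.symm hW

lemma isCoTStructure_of_shift_left (H : IsTriCotorsionPair U V)
    (hU : ∀ X : T, U X → U (X⟦(-1 : ℤ)⟧)) : IsCoTStructure U V where
  shiftU := hU
  shiftV Y hY := H.mem_right_of_hom_zero fun Z hZ f =>
    hom_shift_eq_zero (H.hom_zero (hU Z hZ) hY) f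
  hom_zero hX hY g := hom_shift_neg_eq_zero (H.hom_zero hX hY) g
  exists_tri C := by
    obtain ⟨W, Z, i, p, h, mem, hZ, hW⟩ := H.tri_right C
    exact ⟨Z⟦(-1 : ℤ)⟧, W, _, _, _, inv_rot_of_distTriang _ mem,
      H.isoU ((shiftFunctorCompIsoId T (-1 : ℤ) 1 (by simp)).symm.app Z) hZ, hW⟩

lemma shift_left_of_shift_right (H : IsTriCotorsionPair U V)
    (hV : ∀ X : T, V X → V (X⟦(1 : ℤ)⟧)) (X : T) (hX : U X) : U (X⟦(-1 : ℤ)⟧) :=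
  H.mem_left_of_hom_zero fun W hW g =>
    hom_shift_neg_eq_zero (H.hom_zero hX (hV W hW)) g

lemma hasLift (H : IsTriCotorsionPair U V) {X Y A B : T} {l : X ⟶ Y} {r : A ⟶ B}
    (hl : InflCl U l) (hr : DeflCl V r) : HasLift l r := by
  obtain ⟨Z, q, d, meml, hZ⟩ := hl
  obtain ⟨W, w, e, memr, hW⟩ := hr
  intro f g sq
  have hlq : l ≫ q = 0 := comp_distTriang_mor_zero₁₂ _ meml
  obtain ⟨t₀, ht₀⟩ : ∃ t₀ : Y ⟶ A, f = l ≫ t₀ := by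
    obtain ⟨δ, hδl, hδ⟩ := exists_hom_shift_neg_exact meml
    refine hδ f ?_
    obtain ⟨a, ha⟩ : ∃ a : Z⟦(-1 : ℤ)⟧ ⟶ W, δ ≫ f = a ≫ w :=
      Triangle.coyoneda_exact₂ _ memr (δ ≫ f) (by
        change (δ ≫ f) ≫ r = 0
        rw [Category.assoc, ← sq, reassoc_of% hδl, zero_comp])
    rw [ha, hom_shift_neg_eq_zero (H.hom_zero hZ hW) a, zero_comp]
  obtain ⟨k, hk⟩ : ∃ k : Z ⟶ B, g - t₀ ≫ r = q ≫ k :=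
    Triangle.yoneda_exact₂ _ meml (g - t₀ ≫ r) (by
      change l ≫ _ = 0
      rw [Preadditive.comp_sub, sq, ht₀, Category.assoc, sub_self])
  obtain ⟨k', hk'⟩ : ∃ k' : Z ⟶ A, k = k' ≫ r :=
    Triangle.coyoneda_exact₃ _ memr k (H.hom_zero hZ hW _)
  refine ⟨t₀ + q ≫ k', ?_, ?_⟩
  · rw [Preadditive.comp_add, ← ht₀, reassoc_of% hlq, zero_comp, add_zero]
  · rw [Preadditive.add_comp, Category.assoc, ← hk', ← hk, add_sub_cancel]

lemma infl_of_retract (H : IsTriCotorsionPair U V) {X Y M : T} {f : X ⟶ Y} {g : X ⟶ M}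
    (hg : InflCl U g) (s : Y ⟶ M) (p : M ⟶ Y) (hfs : f ≫ s = g) (hgp : g ≫ p = f)
    (hsp : s ≫ p = 𝟙 Y) : InflCl U f := by
  obtain ⟨Z, q, d, mem, hZ⟩ := hg
  obtain ⟨Z', q', d', mem'⟩ := distinguished_cocone_triangle f
  let φ := completeDistinguishedTriangleMorphism _ _ mem' mem (𝟙 X) s (hfs.trans (Category.id_comp g).symm)
  let ψ := completeDistinguishedTriangleMorphism _ _ mem mem' (𝟙 X) p (hgp.trans (Category.id_comp f).symm)
  obtain ⟨j, hj, -⟩ : IsIso (φ ≫ ψ).hom₃ := isIso₃_of_isIso₁₂ (φ ≫ ψ) mem' mem'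
    (by change IsIso (𝟙 X ≫ 𝟙 X); infer_instance)
    (by change IsIso (s ≫ p); rw [hsp]; infer_instance)
  exact ⟨Z', q', d', mem', H.summandU φ.hom₃ (ψ.hom₃ ≫ j)
    ((Category.assoc _ _ _).symm.trans hj) hZ⟩

lemma defl_of_retract (H : IsTriCotorsionPair U V) {X Y M : T} {f : X ⟶ Y} {g : M ⟶ Y}
    (hg : DeflCl V g) (s : X ⟶ M) (p : M ⟶ X) (hsg : s ≫ g = f) (hpf : p ≫ f = g)
    (hsp : s ≫ p = 𝟙 X) : DeflCl V f := by
  obtain ⟨W, w, d, mem, hW⟩ := hg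
  obtain ⟨W', w', d', mem'⟩ := distinguished_cocone_triangle₁ f
  obtain ⟨a, ha, ha'⟩ := complete_distinguished_triangle_morphism₁ _ _ mem' mem s (𝟙 Y)
    ((Category.comp_id f).trans hsg.symm)
  obtain ⟨b, hb, hb'⟩ := complete_distinguished_triangle_morphism₁ _ _ mem mem' p (𝟙 Y)
    ((Category.comp_id g).trans hpf.symm)
  let φ : Triangle.mk w' f d' ⟶ Triangle.mk w g d :=
    Triangle.homMk _ _ a s (𝟙 Y) ha ((Category.comp_id f).trans hsg.symm) ha'
  let ψ : Triangle.mk w g d ⟶ Triangle.mk w' f d' :=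
    Triangle.homMk _ _ b p (𝟙 Y) hb ((Category.comp_id g).trans hpf.symm) hb'
  obtain ⟨j, hj, -⟩ : IsIso (φ ≫ ψ).hom₁ := isIso₁_of_isIso₂₃ (φ ≫ ψ) mem' mem'
    (by change IsIso (s ≫ p); rw [hsp]; infer_instance)
    (by change IsIso (𝟙 Y ≫ 𝟙 Y); infer_instance)
  exact ⟨W', w', d', mem', H.summandV φ.hom₁ (ψ.hom₁ ≫ j)
    ((Category.assoc _ _ _).symm.trans hj) hW⟩

lemma exists_factorization [IsTriangulated T] (H : IsTriCotorsionPair U V) {X Y : T}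
    (h : X ⟶ Y) :
    ∃ (M : T) (f : X ⟶ M) (g : M ⟶ Y), InflCl U f ∧ DeflCl V g ∧ f ≫ g = h := by
  obtain ⟨C, c, d, memC⟩ := distinguished_cocone_triangle h
  obtain ⟨W, Z, i, p, e, memW, hZ, hW⟩ := H.tri_left C
  obtain ⟨M, m, g, memM⟩ := distinguished_cocone_triangle₂ (c ≫ e)
  let o := Triangulated.someOctahedron' (rfl : c ≫ e = c ≫ e) memC
    (rot_of_distTriang _ memW) (rot_of_distTriang _ memM)
  exact ⟨M, o.m₁, g, ⟨Z, _, _, o.mem, hZ⟩, ⟨W, m, _, memM, hW⟩, o.comm₁⟩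

lemma isWFS [IsTriangulated T] (H : IsTriCotorsionPair U V) :
    IsWFS (InflCl U) (DeflCl V) := by
  refine ⟨fun f => ⟨fun hf _ _ _ hr => H.hasLift hf hr, fun hf => ?_⟩,
    fun g => ⟨fun hg _ _ _ hl => H.hasLift hl hg, fun hg => ?_⟩,
    fun h => H.exists_factorization h⟩
  · obtain ⟨M, l, r, hl, hr, fac⟩ := H.exists_factorization f
    obtain ⟨t, ht, ht'⟩ := hf r hr l (𝟙 _) (by simp [fac])
    exact H.infl_of_retract hl t r ht fac ht'
  · obtain ⟨M, l, r, hl, hr, fac⟩ := H.exists_factorization g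
    obtain ⟨t, ht, ht'⟩ := hg l hl (𝟙 _) r (by simp [fac])
    exact H.defl_of_retract hr l t fac ht' ht

lemma leftCancel [IsTriangulated T] (H : IsTriCotorsionPair U V)
    (hU : ∀ X : T, U X → U (X⟦(-1 : ℤ)⟧)) : LeftCancel (InflCl U) := by
  rintro X Y Z α β ⟨A, _, _, hA, hUA⟩ ⟨B, _, _, hB, hUB⟩
  obtain ⟨C, _, _, hC⟩ := distinguished_cocone_triangle α
  let o := Triangulated.someOctahedron (rfl : α ≫ β = α ≫ β) hC hB hA
  refine ⟨C, _, _, hC, H.mem_left_of_hom_zero fun W hW f => ?_⟩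
  obtain ⟨δ, -, hδ⟩ := exists_hom_shift_neg_exact o.mem
  obtain ⟨k, hk⟩ := hδ f (H.hom_zero (hU _ hUB) hW _)
  rw [hk, H.hom_zero hUA hW k, comp_zero]

lemma rightCancel [IsTriangulated T] (H : IsTriCotorsionPair U V)
    (hV : ∀ X : T, V X → V (X⟦(1 : ℤ)⟧)) : RightCancel (DeflCl V) := by
  rintro X Y Z α β ⟨A, _, _, hA, hVA⟩ ⟨B, _, _, hB, hVB⟩
  obtain ⟨C, _, _, hC⟩ := distinguished_cocone_triangle₁ β
  let o := Triangulated.someOctahedron' (rfl : α ≫ β = α ≫ β) hB hC hA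
  refine ⟨C, _, _, hC, H.mem_right_of_hom_zero fun Z hZ f => ?_⟩
  obtain ⟨k, hk⟩ := Triangle.coyoneda_exact₁ _
    (rot_of_distTriang _ (rot_of_distTriang _ o.mem)) f (H.hom_zero hZ (hV _ hVB) _)
  rw [hk]
  exact (congrArg (· ≫ _) (H.hom_zero hZ hVA k)).trans zero_comp

end IsTriCotorsionPair

lemma inflCl_to_zero {X : T} (hX : U X) : InflCl U (0 : X⟦(-1 : ℤ)⟧ ⟶ 0) :=
  ⟨X, _, _, distTriang_to_zero X, hX⟩

lemma deflCl_to_zero {X : T} (hX : V X) : DeflCl V (0 : X ⟶ 0) :=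
  ⟨X, _, _, contractible_distinguished X, hX⟩

lemma deflCl_from_zero {X : T} (hX : V X) : DeflCl V (0 : 0 ⟶ X⟦(1 : ℤ)⟧) :=
  ⟨X, _, _, contractible_distinguished₂ X, hX⟩

lemma mem_of_inflCl_from_zero (hU : ∀ {X Y : T}, (X ≅ Y) → U X → U Y) {X : T}
    {f : 0 ⟶ X} (hf : InflCl U f) : U X := by
  obtain ⟨Z, g, h, mem, hZ⟩ := hf
  have : IsIso g := (Triangle.isZero₁_iff_isIso₂ _ mem).1 (isZero_zero T)
  exact hU (asIso g).symm hZ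

lemma mem_of_deflCl_to_zero (hV : ∀ {X Y : T}, (X ≅ Y) → V X → V Y) {X : T}
    {f : X ⟶ 0} (hf : DeflCl V f) : V X := by
  obtain ⟨W, w, h, mem, hW⟩ := hf
  have : IsIso w := (Triangle.isZero₃_iff_isIso₁ _ mem).1 (isZero_zero T)
  exact hV (asIso w) hW

lemma IsWFS.left_id {C : Type*} [Category* C] {L R : MorphismProperty C} (H : IsWFS L R)
    (X : C) : L (𝟙 X) :=
  (H.1 _).2 fun _ _ f g sq => ⟨f, by simp, by simpa using sq.symm⟩

lemma IsWFS.right_id {C : Type*} [Category* C] {L R : MorphismProperty C} (H : IsWFS L R)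
    (X : C) : R (𝟙 X) :=
  (H.2.1 _).2 fun _ _ f g sq => ⟨g, by simpa using sq, by simp⟩

lemma IsWFS.isTriCotorsionPair (H : IsWFS (InflCl U) (DeflCl V))
    (hU : ∀ {X Y : T}, (X ≅ Y) → U X → U Y)
    (hV : ∀ {X Y : T}, (X ≅ Y) → V X → V Y)
    (hUs : ∀ {X Z : T} (i : X ⟶ Z) (r : Z ⟶ X), i ≫ r = 𝟙 X → U Z → U X)
    (hVs : ∀ {X Z : T} (i : X ⟶ Z) (r : Z ⟶ X), i ≫ r = 𝟙 X → V Z → V X) :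
    IsTriCotorsionPair U V where
  isoU := hU
  isoV := hV
  summandU := hUs
  summandV := hVs
  hom_zero hX hY f := by
    refine hom_shift_eq_zero (fun g => ?_) f
    obtain ⟨t, ht, -⟩ := (H.1 _).1 (inflCl_to_zero hX) _ (deflCl_to_zero hY) g 0 (by simp)
    rw [← ht, zero_comp]
  tri_left C := by
    obtain ⟨M, f, g, hf, ⟨W, w, h, mem, hW⟩, -⟩ := H.2.2 (0 : 0 ⟶ C)
    exact ⟨W, M, w, g, h, mem, mem_of_inflCl_from_zero hU hf, hW⟩
  tri_right C := by
    obtain ⟨M, f, g, ⟨Z, q, d, mem, hZ⟩, hg, -⟩ := H.2.2 (0 : C ⟶ 0)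
    exact ⟨M, Z, f, q, d, mem, hZ, mem_of_deflCl_to_zero hV hg⟩

lemma LeftCancel.shift_left (hL : LeftCancel (InflCl U)) (H : IsWFS (InflCl U) (DeflCl V))
    (hU : ∀ {X Y : T}, (X ≅ Y) → U X → U Y) (X : T) (hX : U X) : U (X⟦(-1 : ℤ)⟧) := by
  refine mem_of_inflCl_from_zero hU (hL 0 0 ?_ (inflCl_to_zero hX))
  convert! H.left_id (0 : T)
  exact (isZero_zero T).eq_of_src _ _

lemma RightCancel.shift_right (hR : RightCancel (DeflCl V))
    (H : IsWFS (InflCl U) (DeflCl V))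
    (hV : ∀ {X Y : T}, (X ≅ Y) → V X → V Y) (X : T) (hX : V X) : V (X⟦(1 : ℤ)⟧) := by
  refine mem_of_deflCl_to_zero hV (hR 0 0 ?_ (deflCl_from_zero hX))
  convert! H.right_id (0 : T)
  exact (isZero_zero T).eq_of_src _ _

end Cotorsion

variable {T : Type u} [Category.{v} T] [HasZeroObject T] [HasShift T ℤ]
  [Preadditive T] [∀ n : ℤ, (shiftFunctor T n).Additive] [Pretriangulated T]
  [IsTriangulated T]

/-- For classes `U`, `V` closed under isomorphisms and direct summands in a triangulated
category, the following are equivalent: (1) `(U, V)` is a co-t-structure;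
(2) `(Infl(U), Defl(V))` is a weak factorization system with `Infl(U)` satisfying left
cancellation; (3) `(Infl(U), Defl(V))` is a weak factorization system with `Defl(V)`
satisfying right cancellation. -/
theorem stmt16 (U V : T → Prop)
    (hU : ∀ {X Y : T}, (X ≅ Y) → U X → U Y)
    (hV : ∀ {X Y : T}, (X ≅ Y) → V X → V Y)
    (hUs : ∀ {X Z : T} (i : X ⟶ Z) (r : Z ⟶ X), i ≫ r = 𝟙 X → U Z → U X)
    (hVs : ∀ {X Z : T} (i : X ⟶ Z) (r : Z ⟶ X), i ≫ r = 𝟙 X → V Z → V X) :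
    (IsCoTStructure U V ↔ (IsWFS (InflCl U) (DeflCl V) ∧ LeftCancel (InflCl U))) ∧
    (IsCoTStructure U V ↔ (IsWFS (InflCl U) (DeflCl V) ∧ RightCancel (DeflCl V))) := by
  refine ⟨⟨fun H => ?_, fun ⟨H, hL⟩ => ?_⟩, ⟨fun H => ?_, fun ⟨H, hR⟩ => ?_⟩⟩
  · have P := H.isTriCotorsionPair hU hV hUs hVs
    exact ⟨P.isWFS, P.leftCancel H.shiftU⟩
  · exact (H.isTriCotorsionPair hU hV hUs hVs).isCoTStructure_of_shift_left
      (hL.shift_left H hU)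
  · have P := H.isTriCotorsionPair hU hV hUs hVs
    exact ⟨P.isWFS, P.rightCancel H.shiftV⟩
  · have P := H.isTriCotorsionPair hU hV hUs hVs
    exact P.isCoTStructure_of_shift_left (P.shift_left_of_shift_right (hR.shift_right H hV))
end
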